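/- Let m ≥ 1 and suppose x ≠ 1. Then for every k with 0 ≤ k ≤ mp − 1, lim_{n→∞} M_{k+1}^{(m)}(n)/M^{(m)}(n) = (1−x)^{−mp} · Σ_{j=k+1}^{mp} C(mp,j)·(−x)^{mp−j}. -/

import Mathlib

open Filter Finset

/-- The Pochhammer symbol `(z)_n = z (z+1) ⋯ (z+n-1)` over `ℂ`. -/
noncomputable def poch (z : ℂ) (n : ℕ) : ℂ := (ascPochhammer ℂ n).eval z

/-- The terms `a_n = ([α]_n / [β]_n) · x^n` of the generalized hypergeometric series. -/
noncomputable def term (p : ℕ) (α β : Fin p → ℂ) (x : ℂ) (n : ℕ) : ℂ :=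
  ((∏ i, poch (α i) n) / (∏ i, poch (β i) n)) * x ^ n

/-- The partial sums `s_n = ∑_{j=0}^{n-1} a_j`. -/
noncomputable def psum (p : ℕ) (α β : Fin p → ℂ) (x : ℂ) (n : ℕ) : ℂ :=
  ∑ j ∈ Finset.range n, term p α β x j

/-- The coefficients `λ_j^{(m)}(n)`. -/
noncomputable def lam (p : ℕ) (α β : Fin p → ℂ) (x : ℂ) (m j n : ℕ) : ℂ :=
  ((m * p).choose j : ℂ) * (-x) ^ (m * p - j) *
    ∏ i, (poch (α i + (n : ℂ) + (j : ℂ)) (m * p - j) * poch (β i + (n : ℂ) + (m : ℂ) - 1) j)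

/-- `M_k^{(m)}(n) = ∑_{j=k}^{mp} λ_j^{(m)}(n)`; `M^{(m)}(n)` is the case `k = 0`. -/
noncomputable def Mk (p : ℕ) (α β : Fin p → ℂ) (x : ℂ) (m k n : ℕ) : ℂ :=
  ∑ j ∈ Finset.Icc k (m * p), lam p α β x m j n

/-- The transformation `Q_n^{(m)}`. -/
noncomputable def Qt (p : ℕ) (α β : Fin p → ℂ) (x : ℂ) (m n : ℕ) : ℂ :=
  (∑ j ∈ Finset.range (m * p + 1), lam p α β x m j n * psum p α β x (n + j)) /
    Mk p α β x m 0 n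

/-- `(a + n)_j / n ^ j → 1` as `n → ∞`. -/
theorem tendsto_poch_add_div_pow (a : ℂ) (j : ℕ) :
    Tendsto (fun n : ℕ => poch (a + n) j / (n : ℂ) ^ j) atTop (nhds 1) := by
  induction j with
  | zero => simp [poch]
  | succ j ih =>
    have h : Tendsto (fun n : ℕ => (a + j) / (n : ℂ) + 1) atTop (nhds 1) := by
      simpa using (tendsto_const_div_atTop_nhds_zero_nat (a + j : ℂ)).add_const 1
    have h2 := ih.mul h
    rw [one_mul] at h2
    refine h2.congr' ?_
    filter_upwards [eventually_ne_atTop 0] with n hn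
    have hn' : (n : ℂ) ≠ 0 := Nat.cast_ne_zero.mpr hn
    simp only [poch, ascPochhammer_succ_eval]
    field_simp
    ring

/-- `λ_j^{(m)}(n)`, divided by `n ^ (m p²)`, tends to its binomial coefficient factor. -/
theorem tendsto_lam_div_pow (p : ℕ) (α β : Fin p → ℂ) (x : ℂ) (m j : ℕ) (hj : j ≤ m * p) :
    Tendsto (fun n : ℕ => lam p α β x m j n / ((n : ℂ) ^ (m * p)) ^ p) atTop
      (nhds (((m * p).choose j : ℂ) * (-x) ^ (m * p - j))) := by
  have h : Tendsto (fun n : ℕ => ∏ i : Fin p,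
      (poch (α i + j + n) (m * p - j) / (n : ℂ) ^ (m * p - j) *
        (poch (β i + m - 1 + n) j / (n : ℂ) ^ j))) atTop (nhds (∏ _i : Fin p, (1 * 1))) :=
    tendsto_finsetProd _ fun i _ =>
      (tendsto_poch_add_div_pow _ _).mul (tendsto_poch_add_div_pow _ _)
  have h2 := h.const_mul (((m * p).choose j : ℂ) * (-x) ^ (m * p - j))
  simp only [mul_one, prod_const_one] at h2
  refine h2.congr fun n => ?_
  have hpow : ((n : ℂ) ^ (m * p)) ^ p
      = ∏ _i : Fin p, ((n : ℂ) ^ (m * p - j) * (n : ℂ) ^ j) := by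
    rw [← pow_add, Nat.sub_add_cancel hj]
    simp
  rw [lam, hpow, mul_div_assoc, ← prod_div_distrib]
  congr 1
  refine prod_congr rfl fun i _ => ?_
  rw [div_mul_div_comm, add_right_comm (α i), show β i + m - 1 + n = β i + n + m - 1 by ring]

/-- `M_k^{(m)}(n)`, divided by `n ^ (m p²)`, tends to a tail of a binomial expansion. -/
theorem tendsto_Mk_div_pow (p : ℕ) (α β : Fin p → ℂ) (x : ℂ) (m k : ℕ) :
    Tendsto (fun n : ℕ => Mk p α β x m k n / ((n : ℂ) ^ (m * p)) ^ p) atTop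
      (nhds (∑ j ∈ Finset.Icc k (m * p), ((m * p).choose j : ℂ) * (-x) ^ (m * p - j))) := by
  simp only [Mk, sum_div]
  exact tendsto_finsetSum _ fun j hj => tendsto_lam_div_pow p α β x m j (mem_Icc.mp hj).2

/-- For `x ≠ 1` and `0 ≤ k ≤ mp - 1`,
`lim_{n→∞} M_{k+1}^{(m)}(n)/M^{(m)}(n) = (1-x)^{-mp} · ∑_{j=k+1}^{mp} C(mp,j)(−x)^{mp−j}`. -/
theorem Mk_ratio_tendsto
    (p : ℕ) (hp : 1 ≤ p) (α β : Fin p → ℂ) (x : ℂ) (hx : x ≠ 1)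
    (m : ℕ) (hm : 1 ≤ m) (k : ℕ) (hk : k ≤ m * p - 1) :
    Filter.Tendsto (fun n : ℕ => Mk p α β x m (k + 1) n / Mk p α β x m 0 n)
      Filter.atTop
      (nhds (((1 - x) ^ (m * p))⁻¹ *
        ∑ j ∈ Finset.Icc (k + 1) (m * p), ((m * p).choose j : ℂ) * (-x) ^ (m * p - j))) := by
  have hsum : ∑ j ∈ Finset.Icc 0 (m * p), ((m * p).choose j : ℂ) * (-x) ^ (m * p - j)
      = (1 - x) ^ (m * p) := by
    rw [sub_eq_add_neg, add_pow, ← Nat.range_succ_eq_Icc_zero]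
    exact sum_congr rfl fun j _ => by ring
  have hden := tendsto_Mk_div_pow p α β x m 0
  rw [hsum] at hden
  have h := (tendsto_Mk_div_pow p α β x m (k + 1)).div hden
    (pow_ne_zero _ (sub_ne_zero.mpr hx.symm))
  rw [← div_eq_inv_mul]
  refine h.congr' ?_
  filter_upwards [eventually_ne_atTop 0] with n hn
  exact div_div_div_cancel_right₀
    (pow_ne_zero _ (pow_ne_zero _ (Nat.cast_ne_zero.mpr hn))) _ _
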